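/- For all 1 ≤ i, j ≤ r and all integers m, the space Hom_{D(Mod Λ)}(X_j, Σ^m T_i) is one-dimensional over K if i = j and m = 0, and is zero otherwise. -/

import Mathlib

open CategoryTheory Limits Pretriangulated ZeroObject

noncomputable section

namespace RickardKoenigYang

universe w v u

variable (K : Type) [Field K] [IsAlgClosed K]
variable (Λ : Type) [Ring Λ] [Algebra K Λ] [FiniteDimensional K Λ]

/-- `Λ` is a basic algebra (over the algebraically closed field `K`): every simple
`Λ`-module is one-dimensional over `K`. -/
def IsBasicAlgebra : Prop :=
  ∀ (M : Type) [AddCommGroup M] [Module K M] [Module Λ M] [IsScalarTower K Λ M],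
    IsSimpleModule Λ M → Module.finrank K M = 1

/-- A complete family of `r` pairwise non-isomorphic simple `Λ`-modules; this expresses
that `r` is the rank of the Grothendieck group of `mod Λ`. -/
def IsCompleteFamilyOfSimples (r : ℕ) : Prop :=
  ∃ S : Fin r → ModuleCat.{0} Λ,
    (∀ i, IsSimpleModule Λ (S i)) ∧
    (∀ i j, i ≠ j → IsEmpty (S i ≅ S j)) ∧
    (∀ M : ModuleCat.{0} Λ, IsSimpleModule Λ M → ∃ i, Nonempty (M ≅ S i))

section Thick

variable {C : Type u} [Category.{v} C] [Preadditive C] [HasZeroObject C] [HasShift C ℤ]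
  [∀ n : ℤ, (shiftFunctor C n).Additive] [Pretriangulated C]

/-- Membership in the thick (= épaisse) triangulated subcategory generated by a set `S`
of objects: the closure of `S` under isomorphisms, shifts, extensions
(cones of morphisms) and direct summands. -/
inductive ThickMem (S : Set C) : C → Prop
  | of (X : C) (hX : X ∈ S) : ThickMem S X
  | zero : ThickMem S 0
  | iso {X Y : C} (e : X ≅ Y) (hX : ThickMem S X) : ThickMem S Y
  | shift (X : C) (n : ℤ) (hX : ThickMem S X) : ThickMem S (X⟦n⟧)
  | ext (T : Triangle C) (hT : T ∈ distTriang C) (h₁ : ThickMem S T.obj₁)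
      (h₃ : ThickMem S T.obj₃) : ThickMem S T.obj₂
  | summand {X Y : C} (i : X ⟶ Y) (p : Y ⟶ X) (hip : i ≫ p = 𝟙 X) (hY : ThickMem S Y) :
      ThickMem S X

end Thick

variable [HasDerivedCategory (ModuleCat.{0} Λ)]

/-- An object of `D(Mod Λ)` belongs to `D^b(mod Λ)`: it is isomorphic to a bounded
complex of finitely generated `Λ`-modules. -/
def IsDbObject (C : DerivedCategory (ModuleCat.{0} Λ)) : Prop :=
  ∃ M : CochainComplex (ModuleCat.{0} Λ) ℤ,
    (∃ a b : ℤ, ∀ n : ℤ, (n < a ∨ b < n) → IsZero (M.X n)) ∧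
    (∀ n : ℤ, Module.Finite Λ (M.X n)) ∧
    Nonempty (DerivedCategory.Q.obj M ≅ C)

variable [CategoryTheory.Linear K (DerivedCategory (ModuleCat.{0} Λ))]
  [(DerivedCategory.Qh (C := ModuleCat.{0} Λ)).Linear K]

/-- A simple-minded collection `X_1, …, X_r` in `D^b(mod Λ) ⊆ D(Mod Λ)`. -/
structure IsSimpleMindedCollection (r : ℕ) (X : Fin r → DerivedCategory (ModuleCat.{0} Λ)) :
    Prop where
  mem_Db : ∀ i, IsDbObject Λ (X i)
  hom_neg_shift_vanish : ∀ i j (m : ℤ), m < 0 → ∀ f : X i ⟶ (X j)⟦m⟧, f = 0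
  end_dim : ∀ i, Module.finrank K (X i ⟶ X i) = 1
  hom_ne_vanish : ∀ i j, i ≠ j → ∀ f : X i ⟶ X j, f = 0
  generates : ∀ C : DerivedCategory (ModuleCat.{0} Λ), IsDbObject Λ C ↔ ThickMem (Set.range X) C

variable {Λ}

/-- The data of Rickard's construction of the objects `T_1, …, T_r` from a collection
`X_1, …, X_r`: the sequences `X_i = X_i⁽⁰⁾ → X_i⁽¹⁾ → ⋯`, where `X_i⁽ⁿ⁺¹⁾` is a cone of
the canonical map `Z_i⁽ⁿ⁾ = ⊕_{m<0} ⊕_j ⊕_{B(j,m,i,n)} Σ^m X_j → X_i⁽ⁿ⁾` whose component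
corresponding to a basis vector `f ∈ B(j,m,i,n)` of `Hom(Σ^m X_j, X_i⁽ⁿ⁾)` is `f` itself,
and `T_i` is the Milnor colimit of the sequence. -/
structure RickardData (r : ℕ) (X : Fin r → DerivedCategory (ModuleCat.{0} Λ)) where
  /-- the objects `X_i⁽ⁿ⁾` -/
  Xs : Fin r → ℕ → DerivedCategory (ModuleCat.{0} Λ)
  Xs_zero : ∀ i, Xs i 0 = X i
  /-- `B j m i n` is a chosen basis of `Hom(Σ^m X_j, X_i⁽ⁿ⁾)` (for `m < 0`) -/
  B : ∀ (j : Fin r) (m : ℤ) (i : Fin r) (n : ℕ), Set ((X j)⟦m⟧ ⟶ Xs i n)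
  B_indep : ∀ j m i n, m < 0 →
    LinearIndependent K (fun f : B j m i n => (f : (X j)⟦m⟧ ⟶ Xs i n))
  B_span : ∀ j m i n, m < 0 → Submodule.span K (B j m i n) = ⊤
  /-- the objects `Z_i⁽ⁿ⁾` -/
  Z : Fin r → ℕ → DerivedCategory (ModuleCat.{0} Λ)
  /-- the coproduct inclusions into `Z_i⁽ⁿ⁾` -/
  inc : ∀ (i : Fin r) (n : ℕ)
      (p : Σ (j : Fin r) (m : ℤ), {f : (X j)⟦m⟧ ⟶ Xs i n // m < 0 ∧ f ∈ B j m i n}),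
      (X p.1)⟦p.2.1⟧ ⟶ Z i n
  isColimitZ : ∀ i n, Nonempty (IsColimit (Cofan.mk (Z i n) (inc i n)))
  /-- the canonical morphism `α_i⁽ⁿ⁾ : Z_i⁽ⁿ⁾ → X_i⁽ⁿ⁾` -/
  α : ∀ i n, Z i n ⟶ Xs i n
  inc_α : ∀ i n p, inc i n p ≫ α i n = p.2.2.1
  /-- the morphisms `β_i⁽ⁿ⁾ : X_i⁽ⁿ⁾ → X_i⁽ⁿ⁺¹⁾` -/
  β : ∀ i n, Xs i n ⟶ Xs i (n + 1)
  γ : ∀ i n, Xs i (n + 1) ⟶ (Z i n)⟦(1 : ℤ)⟧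
  dist : ∀ i n, Triangle.mk (α i n) (β i n) (γ i n) ∈ distTriang (DerivedCategory (ModuleCat.{0} Λ))
  /-- the objects `T_i` -/
  T : Fin r → DerivedCategory (ModuleCat.{0} Λ)
  /-- the coproducts `⊕_{n ≥ 0} X_i⁽ⁿ⁾` -/
  CP : Fin r → DerivedCategory (ModuleCat.{0} Λ)
  cinc : ∀ (i : Fin r) (n : ℕ), Xs i n ⟶ CP i
  isColimitCP : ∀ i, Nonempty (IsColimit (Cofan.mk (CP i) (cinc i)))
  /-- the morphism `id - β : ⊕ X_i⁽ⁿ⁾ → ⊕ X_i⁽ⁿ⁾` -/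
  oneSubβ : ∀ i, CP i ⟶ CP i
  cinc_oneSubβ : ∀ i n, cinc i n ≫ oneSubβ i = cinc i n - β i n ≫ cinc i (n + 1)
  toT : ∀ i, CP i ⟶ T i
  δT : ∀ i, T i ⟶ (CP i)⟦(1 : ℤ)⟧
  distT : ∀ i, Triangle.mk (oneSubβ i) (toT i) (δT i) ∈
    distTriang (DerivedCategory (ModuleCat.{0} Λ))

end RickardKoenigYang

namespace RickardKoenigYang

universe w v u

set_option linter.unusedSectionVars false

section SingleHom

open CochainComplex CochainComplex.HomComplex DerivedCategory

variable {C : Type u} [Category.{v} C] [Abelian C]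

lemma homologyMap_fromSingle_isoInv {P : C} {L : CochainComplex C ℤ} {n : ℤ}
    (g : (HomologicalComplex.single C (.up ℤ) n).obj P ⟶ L) (k : P ⟶ L.cycles n)
    (hk : k ≫ L.iCycles n = (HomologicalComplex.singleObjXSelf (.up ℤ) n P).inv ≫ g.f n) :
    (HomologicalComplex.singleObjHomologySelfIso (.up ℤ) n P).inv ≫
      HomologicalComplex.homologyMap g n = k ≫ L.homologyπ n := by
  rw [← HomologicalComplex.singleObjCyclesSelfIso_inv_homologyπ, Category.assoc,
    HomologicalComplex.homologyπ_naturality, ← Category.assoc]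
  congr 1
  rw [← cancel_mono (L.iCycles n), Category.assoc, HomologicalComplex.cyclesMap_i, ← Category.assoc,
    HomologicalComplex.singleObjCyclesSelfIso_inv_iCycles, hk]

lemma homologyMap_toSingle_isoHom {I : C} {L : CochainComplex C ℤ} {n : ℤ}
    (g : L ⟶ (HomologicalComplex.single C (.up ℤ) n).obj I) (k : L.opcycles n ⟶ I)
    (hk : L.pOpcycles n ≫ k = g.f n ≫ (HomologicalComplex.singleObjXSelf (.up ℤ) n I).hom) :
    HomologicalComplex.homologyMap g n ≫
      (HomologicalComplex.singleObjHomologySelfIso (.up ℤ) n I).hom = L.homologyι n ≫ k := by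
  rw [← HomologicalComplex.homologyι_singleObjOpcyclesSelfIso_inv, ← Category.assoc,
    HomologicalComplex.homologyι_naturality, Category.assoc]
  congr 1
  rw [← cancel_epi (L.pOpcycles n), ← Category.assoc, HomologicalComplex.p_opcyclesMap,
    Category.assoc, HomologicalComplex.pOpcycles_singleObjOpcyclesSelfIso_inv, hk]

lemma exists_fromSingle {P : C} [Projective P] {L : CochainComplex C ℤ} {n : ℤ}
    (φ : P ⟶ L.homology n) :
    ∃ g : (HomologicalComplex.single C (.up ℤ) n).obj P ⟶ L,
      (HomologicalComplex.singleObjHomologySelfIso (.up ℤ) n P).inv ≫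
        HomologicalComplex.homologyMap g n = φ := by
  have hk : Projective.factorThru φ (L.homologyπ n) ≫ L.homologyπ n = φ :=
    Projective.factorThru_comp _ _
  refine ⟨HomologicalComplex.mkHomFromSingle
    (Projective.factorThru φ (L.homologyπ n) ≫ L.iCycles n) (by simp), ?_⟩
  rw [homologyMap_fromSingle_isoInv _ (Projective.factorThru φ (L.homologyπ n)), hk]
  simp

lemma exists_toSingle {I : C} [Injective I] {L : CochainComplex C ℤ} {n : ℤ}
    (φ : L.homology n ⟶ I) :
    ∃ g : L ⟶ (HomologicalComplex.single C (.up ℤ) n).obj I,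
      HomologicalComplex.homologyMap g n ≫
        (HomologicalComplex.singleObjHomologySelfIso (.up ℤ) n I).hom = φ := by
  have hk : L.homologyι n ≫ Injective.factorThru φ (L.homologyι n) = φ :=
    Injective.comp_factorThru _ _
  refine ⟨HomologicalComplex.mkHomToSingle
    (L.pOpcycles n ≫ Injective.factorThru φ (L.homologyι n)) (by simp), ?_⟩
  rw [homologyMap_toSingle_isoHom _ (Injective.factorThru φ (L.homologyι n)), hk]
  simp

lemma quotient_map_eq_zero_of_mem_coboundaries {M L : CochainComplex C ℤ} (g : M ⟶ L)
    (hg : Cocycle.ofHom g ∈ coboundaries M L 0) :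
    (HomotopyCategory.quotient C (.up ℤ)).map g = 0 := by
  rw [mem_coboundaries_iff _ (-1) (by simp)] at hg
  obtain ⟨z, hz⟩ := hg
  rw [← Functor.map_zero (HomotopyCategory.quotient C (.up ℤ))]
  exact HomotopyCategory.eq_of_homotopy _ _
    ((Cochain.equivHomotopy g 0).symm ⟨z, by simp [hz]⟩)

lemma quotient_map_fromSingle_eq_zero {P : C} [Projective P] {L : CochainComplex C ℤ} {n : ℤ}
    (g : (HomologicalComplex.single C (.up ℤ) n).obj P ⟶ L)
    (hg : HomologicalComplex.homologyMap g n = 0) :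
    (HomotopyCategory.quotient C (.up ℤ)).map g = 0 := by
  obtain ⟨f, hf, hfg⟩ := Cocycle.fromSingleMk_surjective (X := P) (p := n)
    (Cocycle.ofHom g) n (add_zero n) (n + 1) rfl
  have hv : (HomologicalComplex.singleObjXSelf (.up ℤ) n P).hom ≫ f = g.f n := by
    have := congr_arg (fun z : Cocycle _ _ _ => z.1.v n n (add_zero n)) hfg
    have h2 := this.trans (Cochain.ofHom_v g n)
    simp only [Cocycle.fromSingleMk_coe, Cochain.fromSingleMk_v] at h2
    exact h2
  refine quotient_map_eq_zero_of_mem_coboundaries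
    (M := (CochainComplex.singleFunctor C n).obj P) g ?_
  erw [← hfg]
  rw [Cocycle.fromSingleMk_mem_coboundaries_iff _ _ _ _ _ (n - 1) (by simp)]
  have hk := L.liftCycles_i f (n + 1) (by simp) hf
  have h0 : L.liftCycles f (n + 1) (by simp) hf ≫ L.homologyπ n = 0 := by
    rw [← homologyMap_fromSingle_isoInv g, hg, comp_zero]
    rw [hk, ← hv]; simp
  have hex : (ShortComplex.mk _ _ (L.toCycles_comp_homologyπ (n - 1) n)).Exact :=
    ShortComplex.exact_of_g_is_cokernel _ (L.homologyIsCokernel (n - 1) n (by simp))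
  refine ⟨hex.liftFromProjective _ h0, ?_⟩
  refine Eq.trans ?_ ((congrArg (· ≫ L.iCycles n) (hex.liftFromProjective_comp _ h0)).trans hk)
  simp

lemma quotient_map_toSingle_eq_zero {I : C} [Injective I] {L : CochainComplex C ℤ} {n : ℤ}
    (g : L ⟶ (HomologicalComplex.single C (.up ℤ) n).obj I)
    (hg : HomologicalComplex.homologyMap g n = 0) :
    (HomotopyCategory.quotient C (.up ℤ)).map g = 0 := by
  obtain ⟨f, hf, hfg⟩ := Cocycle.toSingleMk_surjective (X := I) (q := n)
    (Cocycle.ofHom g) n (add_zero n) (n - 1) (by simp)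
  have hv : f ≫ (HomologicalComplex.singleObjXSelf (.up ℤ) n I).inv = g.f n := by
    have := congr_arg (fun z : Cocycle _ _ _ => z.1.v n n (add_zero n)) hfg
    have h2 := this.trans (Cochain.ofHom_v g n)
    simp only [Cocycle.toSingleMk_coe, Cochain.toSingleMk_v] at h2
    exact h2
  refine quotient_map_eq_zero_of_mem_coboundaries
    (L := (CochainComplex.singleFunctor C n).obj I) g ?_
  erw [← hfg]
  rw [Cocycle.toSingleMk_mem_coboundaries_iff _ _ _ _ _ (n + 1) rfl]
  have hk := L.p_descOpcycles f (n - 1) (by simp) hf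
  have h0 : L.homologyι n ≫ L.descOpcycles f (n - 1) (by simp) hf = 0 := by
    rw [← homologyMap_toSingle_isoHom g, hg, zero_comp]
    rw [hk, ← hv]; simp
  have hex : (ShortComplex.mk _ _ (L.homologyι_comp_fromOpcycles n (n + 1))).Exact :=
    ShortComplex.exact_of_f_is_kernel _ (L.homologyIsKernel n (n + 1) (by simp))
  refine ⟨hex.descToInjective _ h0, ?_⟩
  refine Eq.trans ?_ ((congrArg (L.pOpcycles n ≫ ·) (hex.comp_descToInjective _ h0)).trans hk)
  simp

variable [HasDerivedCategory.{w} C]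

instance isKProjective_single (P : C) [Projective P] (n : ℤ) :
    IsKProjective ((HomologicalComplex.single C (.up ℤ) n).obj P) := by
  have : ∀ m : ℤ, Projective (((HomologicalComplex.single C (.up ℤ) n).obj P).X m) := by
    intro m
    by_cases h : m = n
    · subst h
      exact Projective.of_iso (HomologicalComplex.singleObjXSelf (.up ℤ) m P).symm inferInstance
    · exact (HomologicalComplex.isZero_single_obj_X (.up ℤ) n P m h).projective
  exact isKProjective_of_projective _ n

instance isKInjective_single (I : C) [Injective I] (n : ℤ) :
    IsKInjective ((HomologicalComplex.single C (.up ℤ) n).obj I) := by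
  have : ∀ m : ℤ, Injective (((HomologicalComplex.single C (.up ℤ) n).obj I).X m) := by
    intro m
    by_cases h : m = n
    · subst h
      exact Injective.of_iso (HomologicalComplex.singleObjXSelf (.up ℤ) m I).symm inferInstance
    · exact (HomologicalComplex.isZero_single_obj_X (.up ℤ) n I m h).injective
  exact isKInjective_of_injective _ n

lemma Q_map_eq_zero {M L : CochainComplex C ℤ} (g : M ⟶ L)
    (hg : (HomotopyCategory.quotient C (.up ℤ)).map g = 0) : Q.map g = 0 := by
  rw [← cancel_epi ((quotientCompQhIso C).hom.app M), ← quotientCompQhIso_hom_naturality, hg]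
  simp

lemma exists_Q_map_eq_of_Qh_surjective {M L : CochainComplex C ℤ}
    (h : Function.Surjective (Qh.map :
      ((HomotopyCategory.quotient C (.up ℤ)).obj M ⟶
        (HomotopyCategory.quotient C (.up ℤ)).obj L) → _))
    (f : Q.obj M ⟶ Q.obj L) : ∃ g : M ⟶ L, Q.map g = f := by
  obtain ⟨g', hg'⟩ := h
    ((quotientCompQhIso C).hom.app M ≫ f ≫ (quotientCompQhIso C).inv.app L)
  obtain ⟨g, rfl⟩ := (HomotopyCategory.quotient C (.up ℤ)).map_surjective g'
  refine ⟨g, ?_⟩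
  rw [← cancel_epi ((quotientCompQhIso C).hom.app M), ← quotientCompQhIso_hom_naturality, hg']
  simp

lemma homologyMap_eq_zero_of_Q {M L : CochainComplex C ℤ} {n : ℤ} (g : M ⟶ L)
    (h : (homologyFunctor C n).map (Q.map g) = 0) : HomologicalComplex.homologyMap g n = 0 := by
  have h' := NatIso.naturality_1 (homologyFunctorFactors C n) g
  refine h'.symm.trans ?_
  change _ ≫ (homologyFunctor C n).map (Q.map g) ≫ _ = 0
  rw [h, zero_comp, comp_zero]

/-- The degree `n` homology of the complex `P` concentrated in degree `n`. -/
noncomputable def homologyQSingleIso (P : C) (n : ℤ) :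
    (homologyFunctor C n).obj (Q.obj ((HomologicalComplex.single C (.up ℤ) n).obj P)) ≅ P :=
  (homologyFunctorFactors C n).app _ ≪≫ HomologicalComplex.singleObjHomologySelfIso (.up ℤ) n P

lemma homologyQSingleIso_inv_naturality {P : C} {n : ℤ} {L : CochainComplex C ℤ}
    (g : (HomologicalComplex.single C (.up ℤ) n).obj P ⟶ L) :
    (homologyQSingleIso P n).inv ≫ (homologyFunctor C n).map (Q.map g) ≫
        (homologyFunctorFactors C n).hom.app L =
      (HomologicalComplex.singleObjHomologySelfIso (.up ℤ) n P).inv ≫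
        HomologicalComplex.homologyMap g n :=
  (Category.assoc (HomologicalComplex.singleObjHomologySelfIso (.up ℤ) n P).inv
    ((homologyFunctorFactors C n).inv.app _) _).trans
    (congrArg ((HomologicalComplex.singleObjHomologySelfIso (.up ℤ) n P).inv ≫ ·)
      (NatIso.naturality_1 (homologyFunctorFactors C n) g))

lemma homologyQSingleIso_hom_naturality {I : C} {n : ℤ} {L : CochainComplex C ℤ}
    (g : L ⟶ (HomologicalComplex.single C (.up ℤ) n).obj I) :
    (homologyFunctorFactors C n).inv.app L ≫ (homologyFunctor C n).map (Q.map g) ≫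
        (homologyQSingleIso I n).hom =
      HomologicalComplex.homologyMap g n ≫
        (HomologicalComplex.singleObjHomologySelfIso (.up ℤ) n I).hom := by
  refine Eq.trans ?_ (congrArg (· ≫ (HomologicalComplex.singleObjHomologySelfIso (.up ℤ) n I).hom)
      (NatIso.naturality_1 (homologyFunctorFactors C n) g))
  exact (congrArg ((homologyFunctorFactors C n).inv.app L ≫ ·)
    (Category.assoc _ _ _).symm).trans (Category.assoc _ _ _).symm

lemma isZero_homology_Q_single (P : C) (n m : ℤ) (h : m ≠ n) :
    IsZero ((homologyFunctor C m).obj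
      (Q.obj ((HomologicalComplex.single C (.up ℤ) n).obj P))) :=
  (HomologicalComplex.isZero_single_obj_homology (.up ℤ) n P m h).of_iso
    ((homologyFunctorFactors C m).app _)

lemma eq_zero_of_homology_fromSingle {P : C} [Projective P] {Z : DerivedCategory C} {n : ℤ}
    (f : Q.obj ((HomologicalComplex.single C (.up ℤ) n).obj P) ⟶ Z)
    (hf : (homologyFunctor C n).map f = 0) : f = 0 := by
  let e := Q.objObjPreimageIso Z
  obtain ⟨g, hg⟩ := exists_Q_map_eq_of_Qh_surjective
    (IsKProjective.Qh_map_bijective _ _).surjective (f ≫ e.inv)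
  rw [← cancel_mono e.inv, zero_comp, ← hg]
  apply Q_map_eq_zero
  apply quotient_map_fromSingle_eq_zero
  apply homologyMap_eq_zero_of_Q
  rw [hg, Functor.map_comp, hf, zero_comp]

lemma eq_zero_of_homology_toSingle {I : C} [Injective I] {Z : DerivedCategory C} {n : ℤ}
    (f : Z ⟶ Q.obj ((HomologicalComplex.single C (.up ℤ) n).obj I))
    (hf : (homologyFunctor C n).map f = 0) : f = 0 := by
  let e := Q.objObjPreimageIso Z
  obtain ⟨g, hg⟩ := exists_Q_map_eq_of_Qh_surjective
    (IsKInjective.Qh_map_bijective _ _).surjective (e.hom ≫ f)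
  rw [← cancel_epi e.hom, comp_zero, ← hg]
  apply Q_map_eq_zero
  apply quotient_map_toSingle_eq_zero
  apply homologyMap_eq_zero_of_Q
  rw [hg, Functor.map_comp, hf, comp_zero]

lemma exists_hom_fromSingle {P : C} [Projective P] (Z : DerivedCategory C) {n : ℤ}
    (φ : P ⟶ (homologyFunctor C n).obj Z) :
    ∃ f : Q.obj ((HomologicalComplex.single C (.up ℤ) n).obj P) ⟶ Z,
      (homologyQSingleIso P n).inv ≫ (homologyFunctor C n).map f = φ := by
  let e := Q.objObjPreimageIso Z
  obtain ⟨g, hg⟩ := exists_fromSingle (L := Q.objPreimage Z)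
    (φ ≫ (homologyFunctor C n).map e.inv ≫ (homologyFunctorFactors C n).hom.app _)
  refine ⟨Q.map g ≫ e.hom, ?_⟩
  rw [← cancel_mono ((homologyFunctor C n).map e.inv),
    ← cancel_mono ((homologyFunctorFactors C n).hom.app _), Category.assoc φ]
  refine Eq.trans ?_ hg
  have h2 : ((homologyFunctor C n).map (Q.map g ≫ e.hom)) ≫ (homologyFunctor C n).map e.inv =
    (homologyFunctor C n).map (Q.map g) := by
    rw [← Functor.map_comp, Category.assoc, e.hom_inv_id, Category.comp_id]
  refine Eq.trans ?_ (homologyQSingleIso_inv_naturality g)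
  simp only [Category.assoc, reassoc_of% h2]

lemma exists_hom_toSingle {I : C} [Injective I] (Z : DerivedCategory C) {n : ℤ}
    (φ : (homologyFunctor C n).obj Z ⟶ I) :
    ∃ f : Z ⟶ Q.obj ((HomologicalComplex.single C (.up ℤ) n).obj I),
      (homologyFunctor C n).map f ≫ (homologyQSingleIso I n).hom = φ := by
  let e := Q.objObjPreimageIso Z
  obtain ⟨g, hg⟩ := exists_toSingle (L := Q.objPreimage Z)
    ((homologyFunctorFactors C n).inv.app _ ≫ (homologyFunctor C n).map e.hom ≫ φ)
  refine ⟨e.inv ≫ Q.map g, ?_⟩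
  rw [← cancel_epi ((homologyFunctor C n).map e.hom),
    ← cancel_epi ((homologyFunctorFactors C n).inv.app _)]
  refine Eq.trans ?_ hg
  have h2 : (homologyFunctor C n).map e.hom ≫ ((homologyFunctor C n).map (e.inv ≫ Q.map g)) =
    (homologyFunctor C n).map (Q.map g) := by
    rw [← Functor.map_comp, e.hom_inv_id_assoc]
  refine Eq.trans ?_ (homologyQSingleIso_hom_naturality g)
  simp only [reassoc_of% h2]

end SingleHom

section CofanProj

variable {D : Type u} [Category.{v} D] [Preadditive D] {ι : Type*} {Y : ι → D} {Z : D}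
  {inc : ∀ p, Y p ⟶ Z} (hc : IsColimit (Cofan.mk Z inc))

open Classical in
/-- The projection of a coproduct onto one of its summands. -/
def cofanProj (p : ι) : Z ⟶ Y p :=
  hc.desc (Cofan.mk (Y p) fun q => if h : q = p then eqToHom (by rw [h]) else 0)

lemma inc_cofanProj_self (p : ι) : inc p ≫ cofanProj hc p = 𝟙 (Y p) := by
  refine (hc.fac _ ⟨p⟩).trans ?_
  simp

lemma inc_cofanProj_ne {p q : ι} (h : q ≠ p) : inc q ≫ cofanProj hc p = 0 := by
  refine (hc.fac _ ⟨q⟩).trans ?_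
  simp [h]

include hc in
lemma cofan_hom_ext {A : D} {f g : Z ⟶ A} (h : ∀ p, inc p ≫ f = inc p ≫ g) : f = g :=
  hc.hom_ext fun ⟨p⟩ => h p

/-- The idempotent endomorphism of a coproduct projecting onto finitely many summands. -/
def cofanTrunc (s : Finset ι) : Z ⟶ Z := ∑ p ∈ s, cofanProj hc p ≫ inc p

lemma inc_cofanTrunc_of_mem {s : Finset ι} {q : ι} (hq : q ∈ s) :
    inc q ≫ cofanTrunc hc s = inc q := by
  rw [cofanTrunc, Preadditive.comp_sum, Finset.sum_eq_single q]
  · rw [← Category.assoc, inc_cofanProj_self, Category.id_comp]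
  · intro p _ hp
    rw [← Category.assoc, inc_cofanProj_ne hc hp.symm, zero_comp]
  · exact fun h => absurd hq h

lemma inc_cofanTrunc_of_notMem {s : Finset ι} {q : ι} (hq : q ∉ s) :
    inc q ≫ cofanTrunc hc s = 0 := by
  rw [cofanTrunc, Preadditive.comp_sum]
  refine Finset.sum_eq_zero fun p hp => ?_
  rw [← Category.assoc, inc_cofanProj_ne hc (by rintro rfl; exact hq hp), zero_comp]

lemma cofanTrunc_comp {s t : Finset ι} (hst : s ⊆ t) :
    cofanTrunc hc s ≫ cofanTrunc hc t = cofanTrunc hc s := by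
  refine cofan_hom_ext hc fun p => ?_
  by_cases hp : p ∈ s
  · rw [← Category.assoc, inc_cofanTrunc_of_mem hc hp, inc_cofanTrunc_of_mem hc (hst hp)]
  · rw [← Category.assoc, inc_cofanTrunc_of_notMem hc hp, zero_comp]

lemma comp_cofanTrunc_of_subset {A : D} {f : A ⟶ Z} {s t : Finset ι} (hst : s ⊆ t)
    (hf : f ≫ cofanTrunc hc s = f) : f ≫ cofanTrunc hc t = f := by
  rw [← hf, Category.assoc, cofanTrunc_comp hc hst]

/-- Every morphism from `A` to the coproduct factors through finitely many summands. -/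
def FactorsFinitely (A : D) : Prop :=
  ∀ f : A ⟶ Z, ∃ s : Finset ι, f ≫ cofanTrunc hc s = f

lemma FactorsFinitely.eq_sum {A : D} (h : FactorsFinitely hc A) (f : A ⟶ Z) :
    ∃ s : Finset ι, f = ∑ p ∈ s, (f ≫ cofanProj hc p) ≫ inc p := by
  obtain ⟨s, hs⟩ := h f
  refine ⟨s, ?_⟩
  conv_lhs => rw [← hs, cofanTrunc, Preadditive.comp_sum]
  simp

lemma FactorsFinitely.of_iso {A A' : D} (e : A ≅ A') (h : FactorsFinitely hc A) :
    FactorsFinitely hc A' := by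
  intro f
  obtain ⟨s, hs⟩ := h (e.hom ≫ f)
  exact ⟨s, by rwa [Category.assoc, cancel_epi] at hs⟩

open Classical in
lemma FactorsFinitely.ext [HasZeroObject D] [HasShift D ℤ]
    [∀ n : ℤ, (shiftFunctor D n).Additive] [Pretriangulated D]
    (T : Triangle D) (hT : T ∈ distTriang D) (h₁ : FactorsFinitely hc T.obj₁)
    (h₃ : FactorsFinitely hc T.obj₃) : FactorsFinitely hc T.obj₂ := by
  intro f
  obtain ⟨s, hs⟩ := h₁ (T.mor₁ ≫ f)
  obtain ⟨g, hg⟩ := Triangle.yoneda_exact₂ T hT (f - f ≫ cofanTrunc hc s) (by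
    rw [Preadditive.comp_sub, ← Category.assoc, hs, sub_self])
  obtain ⟨t, ht⟩ := h₃ g
  have h : (f - f ≫ cofanTrunc hc s) ≫ cofanTrunc hc (s ∪ t) = f - f ≫ cofanTrunc hc s := by
    rw [hg, Category.assoc, comp_cofanTrunc_of_subset hc Finset.subset_union_right ht]
  refine ⟨s ∪ t, ?_⟩
  rw [Preadditive.sub_comp, Category.assoc, cofanTrunc_comp hc Finset.subset_union_left] at h
  exact sub_left_inj.1 h

end CofanProj

section Homology

open DerivedCategory

variable {Λ : Type} [Ring Λ] [HasDerivedCategory.{w} (ModuleCat.{0} Λ)]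
  {ι : Type*} {Y : ι → DerivedCategory (ModuleCat.{0} Λ)}
  {Z : DerivedCategory (ModuleCat.{0} Λ)} {inc : ∀ p, Y p ⟶ Z}
  (hc : IsColimit (Cofan.mk Z inc))

include hc in
lemma iSup_range_homology_inc (n : ℤ) :
    ⨆ p, LinearMap.range ((homologyFunctor (ModuleCat.{0} Λ) n).map (inc p)).hom = ⊤ := by
  set S := ⨆ p, LinearMap.range ((homologyFunctor (ModuleCat.{0} Λ) n).map (inc p)).hom with hS
  let q : (homologyFunctor (ModuleCat.{0} Λ) n).obj Z ⟶
    ModuleCat.of Λ ((homologyFunctor (ModuleCat.{0} Λ) n).obj Z ⧸ S) := ModuleCat.ofHom S.mkQ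
  have hq : ∀ p, (homologyFunctor (ModuleCat.{0} Λ) n).map (inc p) ≫ q = 0 := by
    intro p
    ext x
    exact (Submodule.Quotient.mk_eq_zero S).2
      (le_iSup (fun p => LinearMap.range
        ((homologyFunctor (ModuleCat.{0} Λ) n).map (inc p)).hom) p ⟨x, rfl⟩)
  obtain ⟨f, hf⟩ := exists_hom_toSingle Z (q ≫ Injective.ι _)
  have hf0 : f = 0 := by
    refine cofan_hom_ext hc fun p => ?_
    rw [comp_zero]
    apply eq_zero_of_homology_toSingle
    rw [← cancel_mono (homologyQSingleIso _ n).hom, Functor.map_comp, Category.assoc, hf,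
      ← Category.assoc, hq, zero_comp, zero_comp]
  rw [hf0, Functor.map_zero, zero_comp] at hf
  have hq0 : q = 0 := by
    rw [← cancel_mono (Injective.ι _), ← hf, zero_comp]
  rw [eq_top_iff]
  intro x _
  rw [← Submodule.Quotient.mk_eq_zero]
  exact congr_arg (fun g => g.hom x) hq0

include hc in
lemma isZero_homology_of_isColimit (n : ℤ)
    (h : ∀ p, IsZero ((homologyFunctor (ModuleCat.{0} Λ) n).obj (Y p))) :
    IsZero ((homologyFunctor (ModuleCat.{0} Λ) n).obj Z) := by
  have h2 := iSup_range_homology_inc hc n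
  have h3 : ∀ p, LinearMap.range ((homologyFunctor (ModuleCat.{0} Λ) n).map (inc p)).hom = ⊥ := by
    intro p
    rw [(h p).eq_of_src ((homologyFunctor (ModuleCat.{0} Λ) n).map (inc p)) 0]
    exact LinearMap.range_zero
  simp only [h3, iSup_bot] at h2
  have := (Submodule.subsingleton_iff Λ).1 (subsingleton_of_bot_eq_top h2)
  exact ModuleCat.isZero_of_subsingleton _

end Homology

section FiniteHomology

open DerivedCategory

variable {Λ : Type} [Ring Λ] [HasDerivedCategory.{w} (ModuleCat.{0} Λ)]

/-- All the homology modules are finitely generated. -/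
def HasFiniteHomology (X : DerivedCategory (ModuleCat.{0} Λ)) : Prop :=
  ∀ n : ℤ, Module.Finite Λ ((homologyFunctor (ModuleCat.{0} Λ) n).obj X)

lemma finite_of_iso {M N : ModuleCat.{0} Λ} (e : M ≅ N) (h : Module.Finite Λ M) :
    Module.Finite Λ N :=
  Module.Finite.equiv e.toLinearEquiv

lemma finite_of_isZero {M : ModuleCat.{0} Λ} (h : IsZero M) : Module.Finite Λ M := by
  have := ModuleCat.subsingleton_of_isZero h
  infer_instance

lemma finite_of_exact [IsNoetherianRing Λ] (S : ShortComplex (ModuleCat.{0} Λ)) (hS : S.Exact)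
    (h₁ : Module.Finite Λ S.X₁) (h₃ : Module.Finite Λ S.X₃) : Module.Finite Λ S.X₂ := by
  have : IsNoetherian Λ S.X₂ := isNoetherian_of_range_eq_ker S.f.hom S.g.hom
    ((ShortComplex.moduleCat_exact_iff_range_eq_ker S).1 hS)
  infer_instance

lemma HasFiniteHomology.of_iso {X Y : DerivedCategory (ModuleCat.{0} Λ)} (e : X ≅ Y)
    (h : HasFiniteHomology X) : HasFiniteHomology Y := fun n =>
  finite_of_iso ((homologyFunctor (ModuleCat.{0} Λ) n).mapIso e) (h n)

lemma HasFiniteHomology.shift {X : DerivedCategory (ModuleCat.{0} Λ)}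
    (h : HasFiniteHomology X) (k : ℤ) : HasFiniteHomology (X⟦k⟧) := fun n =>
  finite_of_iso (((homologyFunctor (ModuleCat.{0} Λ) 0).shiftIso k n (k + n) rfl).app X).symm
    (h (k + n))

lemma HasFiniteHomology.Q_single {P : ModuleCat.{0} Λ} (h : Module.Finite Λ P) (n : ℤ) :
    HasFiniteHomology (Q.obj ((HomologicalComplex.single _ (.up ℤ) n).obj P)) := by
  intro m
  by_cases hm : m = n
  · subst hm
    exact finite_of_iso (homologyQSingleIso P m).symm h
  · exact finite_of_isZero (isZero_homology_Q_single P n m hm)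

lemma HasFiniteHomology.cone [IsNoetherianRing Λ] (T : Triangle (DerivedCategory (ModuleCat.{0} Λ)))
    (hT : T ∈ distTriang _) (h₁ : HasFiniteHomology T.obj₁) (h₂ : HasFiniteHomology T.obj₂) :
    HasFiniteHomology T.obj₃ := fun n =>
  finite_of_exact _ (HomologySequence.exact₃ T hT n (n + 1) rfl) (h₂ n) (h₁ (n + 1))

lemma HasFiniteHomology.Q_obj [IsNoetherianRing Λ] (M : CochainComplex (ModuleCat.{0} Λ) ℤ)
    (hM : ∀ n, Module.Finite Λ (M.X n)) : HasFiniteHomology (Q.obj M) := by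
  intro n
  have h₁ : Module.Finite Λ (M.cycles n) := by
    have := hM n
    exact Module.Finite.of_injective (M.iCycles n).hom
      ((ModuleCat.mono_iff_injective _).1 inferInstance)
  have h₂ : Module.Finite Λ (M.homology n) :=
    Module.Finite.of_surjective (M.homologyπ n).hom
      ((ModuleCat.epi_iff_surjective _).1 inferInstance)
  exact finite_of_iso ((homologyFunctorFactors (ModuleCat.{0} Λ) n).app M).symm h₂

lemma isZero_homology_Q_obj (M : CochainComplex (ModuleCat.{0} Λ) ℤ) (n : ℤ)
    (hM : IsZero (M.X n)) : IsZero ((homologyFunctor (ModuleCat.{0} Λ) n).obj (Q.obj M)) := by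
  have h₁ : IsZero (M.cycles n) := IsZero.of_mono (M.iCycles n) hM
  have h₂ : IsZero (M.homology n) := IsZero.of_epi (M.homologyπ n) h₁
  exact h₂.of_iso ((homologyFunctorFactors (ModuleCat.{0} Λ) n).app M)

lemma isLE_of_iso {X Y : DerivedCategory (ModuleCat.{0} Λ)} (e : X ≅ Y) (n : ℤ) (h : X.IsLE n) :
    Y.IsLE n := by
  rw [isLE_iff] at h ⊢
  exact fun i hi => (h i hi).of_iso ((homologyFunctor (ModuleCat.{0} Λ) i).mapIso e.symm)

lemma isGE_of_iso {X Y : DerivedCategory (ModuleCat.{0} Λ)} (e : X ≅ Y) (n : ℤ) (h : X.IsGE n) :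
    Y.IsGE n := by
  rw [isGE_iff] at h ⊢
  exact fun i hi => (h i hi).of_iso ((homologyFunctor (ModuleCat.{0} Λ) i).mapIso e.symm)

lemma isLE_shift (X : DerivedCategory (ModuleCat.{0} Λ)) (n k m : ℤ) (h : k + m = n)
    (hX : X.IsLE n) : (X⟦k⟧).IsLE m :=
  TStructure.t.isLE_shift X n k m h

lemma isGE_shift (X : DerivedCategory (ModuleCat.{0} Λ)) (n k m : ℤ) (h : k + m = n)
    (hX : X.IsGE n) : (X⟦k⟧).IsGE m :=
  TStructure.t.isGE_shift X n k m h

lemma isGE_mono (X : DerivedCategory (ModuleCat.{0} Λ)) (n m : ℤ) (h : m ≤ n)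
    (hX : X.IsGE n) : X.IsGE m := by
  rw [isGE_iff] at hX ⊢
  exact fun i hi => hX i (by lia)

lemma IsDbObject.hasFiniteHomology [IsNoetherianRing Λ]
    {X : DerivedCategory (ModuleCat.{0} Λ)} (h : IsDbObject Λ X) : HasFiniteHomology X := by
  obtain ⟨M, -, hM, ⟨e⟩⟩ := h
  exact (HasFiniteHomology.Q_obj M hM).of_iso e

lemma IsDbObject.exists_isGE_isLE {X : DerivedCategory (ModuleCat.{0} Λ)}
    (h : IsDbObject Λ X) : ∃ a b : ℤ, X.IsGE a ∧ X.IsLE b := by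
  obtain ⟨M, ⟨a, b, hM⟩, -, ⟨e⟩⟩ := h
  refine ⟨a, b, isGE_of_iso e a ?_, isLE_of_iso e b ?_⟩
  · rw [isGE_iff]
    exact fun i hi => isZero_homology_Q_obj M i (hM i (Or.inl hi))
  · rw [isLE_iff]
    exact fun i hi => isZero_homology_Q_obj M i (hM i (Or.inr hi))

lemma isGE_cone (T : Triangle (DerivedCategory (ModuleCat.{0} Λ)))
    (hT : T ∈ distTriang _) (a : ℤ) (h₁ : T.obj₁.IsGE (a + 1)) (h₂ : T.obj₂.IsGE a) :
    T.obj₃.IsGE a := by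
  rw [isGE_iff] at *
  intro i hi
  exact (HomologySequence.exact₃ T hT i (i + 1) rfl).isZero_of_both_zeros
    ((h₂ i hi).eq_of_src _ _) ((h₁ (i + 1) (by lia)).eq_of_tgt _ _)

variable {ι : Type*} {Y : ι → DerivedCategory (ModuleCat.{0} Λ)}
  {Z : DerivedCategory (ModuleCat.{0} Λ)} {inc : ∀ p, Y p ⟶ Z}
  (hc : IsColimit (Cofan.mk Z inc))

include hc in
lemma isGE_of_isColimit (a : ℤ) (h : ∀ p, (Y p).IsGE a) : Z.IsGE a := by
  rw [isGE_iff]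
  exact fun i hi => isZero_homology_of_isColimit hc i fun p => (isGE_iff _ _).1 (h p) i hi

open Classical in
lemma exists_homology_cofanTrunc_apply (n : ℤ)
    (x : (homologyFunctor (ModuleCat.{0} Λ) n).obj Z) :
    ∃ s : Finset ι, (homologyFunctor (ModuleCat.{0} Λ) n).map (cofanTrunc hc s) x = x := by
  have hx : x ∈ ⨆ p, LinearMap.range ((homologyFunctor (ModuleCat.{0} Λ) n).map (inc p)).hom := by
    rw [iSup_range_homology_inc hc]
    trivial
  have hmono : ∀ (s t : Finset ι) (y : (homologyFunctor (ModuleCat.{0} Λ) n).obj Z), s ⊆ t →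
      (homologyFunctor (ModuleCat.{0} Λ) n).map (cofanTrunc hc s) y = y →
      (homologyFunctor (ModuleCat.{0} Λ) n).map (cofanTrunc hc t) y = y := by
    intro s t y hst hy
    rw [← hy, ← ConcreteCategory.comp_apply, ← Functor.map_comp, cofanTrunc_comp hc hst]
  induction hx using Submodule.iSup_induction' with
  | mem p x hx =>
    obtain ⟨y, rfl⟩ := hx
    refine ⟨{p}, ?_⟩
    change (homologyFunctor (ModuleCat.{0} Λ) n).map (cofanTrunc hc {p})
      ((homologyFunctor (ModuleCat.{0} Λ) n).map (inc p) y) =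
        (homologyFunctor (ModuleCat.{0} Λ) n).map (inc p) y
    rw [← ConcreteCategory.comp_apply, ← Functor.map_comp,
      inc_cofanTrunc_of_mem hc (Finset.mem_singleton_self p)]
  | zero => exact ⟨∅, map_zero _⟩
  | add x y _ _ ihx ihy =>
    obtain ⟨s, hs⟩ := ihx
    obtain ⟨t, ht⟩ := ihy
    refine ⟨s ∪ t, ?_⟩
    rw [map_add, hmono s _ x Finset.subset_union_left hs,
      hmono t _ y Finset.subset_union_right ht]

open Classical in
lemma factorsFinitely_Q_single (k : ℕ) (n : ℤ) :
    FactorsFinitely hc (Q.obj ((HomologicalComplex.single _ (.up ℤ) n).obj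
      (ModuleCat.of Λ (Fin k → Λ)))) := by
  have : Projective (ModuleCat.of Λ (Fin k → Λ)) :=
    (IsProjective.iff_projective _).1 inferInstance
  intro f
  let ψ := (homologyQSingleIso (ModuleCat.of Λ (Fin k → Λ)) n).inv ≫
    (homologyFunctor (ModuleCat.{0} Λ) n).map f
  choose s hs using fun i : Fin k =>
    exists_homology_cofanTrunc_apply hc n (ψ ((Pi.basisFun Λ (Fin k)) i))
  refine ⟨Finset.univ.biUnion s, ?_⟩
  rw [← sub_eq_zero]
  apply eq_zero_of_homology_fromSingle
  rw [Functor.map_sub, sub_eq_zero,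
    ← cancel_epi (homologyQSingleIso (ModuleCat.of Λ (Fin k → Λ)) n).inv]
  change _ = ψ
  rw [Functor.map_comp, ← Category.assoc]
  change ψ ≫ _ = ψ
  apply ModuleCat.hom_ext
  refine (Pi.basisFun Λ (Fin k)).ext fun i => ?_
  change (homologyFunctor (ModuleCat.{0} Λ) n).map _ (ψ _) = ψ _
  rw [← hs i, ← ConcreteCategory.comp_apply, ← Functor.map_comp, cofanTrunc_comp hc
    (Finset.subset_biUnion_of_mem s (Finset.mem_univ i))]

lemma factorsFinitely_of_isGE [IsNoetherianRing Λ] (a : ℤ) (hZ : Z.IsGE a) (d : ℕ) :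
    ∀ (b : ℤ) (_ : b < a + d) (W : DerivedCategory (ModuleCat.{0} Λ)) (_ : W.IsLE b)
      (_ : HasFiniteHomology W), FactorsFinitely hc W := by
  induction d with
  | zero =>
    intro b hb W hW _ f
    have hf : f = 0 := TStructure.t.zero_of_isLE_of_isGE f b a (by simpa using hb) hW hZ
    exact ⟨∅, by simp [hf]⟩
  | succ d ih =>
    intro b hb W hW hfin
    have := hfin b
    obtain ⟨k, φ, hφ⟩ := Module.Finite.exists_fin' Λ
      ((homologyFunctor (ModuleCat.{0} Λ) b).obj W)
    have : Projective (ModuleCat.of Λ (Fin k → Λ)) :=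
      (IsProjective.iff_projective _).1 inferInstance
    obtain ⟨g, hg⟩ := exists_hom_fromSingle W (n := b) (P := ModuleCat.of Λ (Fin k → Λ))
      (ModuleCat.ofHom φ)
    have hepi : Epi ((homologyFunctor (ModuleCat.{0} Λ) b).map g) := by
      have : Epi (ModuleCat.ofHom φ) := (ModuleCat.epi_iff_surjective _).2 hφ
      rw [← hg] at this
      exact epi_of_epi (homologyQSingleIso _ b).inv _
    obtain ⟨V, p, q, hT⟩ := Pretriangulated.distinguished_cocone_triangle g
    have hV : V.IsLE (b - 1) := by
      rw [isLE_iff]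
      intro i hi
      refine (HomologySequence.exact₃ _ hT i (i + 1) rfl).isZero_of_both_zeros ?_
        ((isZero_homology_Q_single _ b (i + 1) (by lia)).eq_of_tgt _ _)
      rcases eq_or_ne i b with rfl | hib
      · exact (HomologySequence.epi_homologyMap_mor₁_iff _ hT i).1 hepi
      · exact ((isLE_iff W b).1 hW i (by lia)).eq_of_src _ _
    exact FactorsFinitely.ext hc _ hT (factorsFinitely_Q_single hc k b)
      (ih (b - 1) (by push_cast at hb; lia) V hV
        (HasFiniteHomology.cone _ hT (HasFiniteHomology.Q_single (by
          change Module.Finite Λ (Fin k → Λ); infer_instance) b) hfin))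

end FiniteHomology

section Rickard

variable {K : Type} [Field K] [IsAlgClosed K]
  {Λ : Type} [Ring Λ] [Algebra K Λ] [FiniteDimensional K Λ]
  [HasDerivedCategory.{w} (ModuleCat.{0} Λ)]
  [CategoryTheory.Linear K (DerivedCategory (ModuleCat.{0} Λ))]
  [(DerivedCategory.Qh (C := ModuleCat.{0} Λ)).Linear K]
  {r : ℕ} {X : Fin r → DerivedCategory (ModuleCat.{0} Λ)}

omit [IsAlgClosed K] [FiniteDimensional K Λ] in
variable (K) in
lemma shiftFunctor_linear (n : ℤ) :
    (shiftFunctor (DerivedCategory (ModuleCat.{0} Λ)) n).Linear K :=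
  Shift.linear_of_localization K DerivedCategory.Qh
    (HomotopyCategory.subcategoryAcyclic (ModuleCat.{0} Λ)).trW n

namespace IsSimpleMindedCollection

variable (hX : IsSimpleMindedCollection K Λ r X)
include hX

lemma hom_shift_eq_zero_of_lt (i j : Fin r) {k l : ℤ} (h : l < k) (f : (X i)⟦k⟧ ⟶ (X j)⟦l⟧) :
    f = 0 := by
  let e := (shiftFunctorAdd' (DerivedCategory (ModuleCat.{0} Λ)) (l - k) k l (by lia)).app (X j)
  obtain ⟨g, hg⟩ := (shiftFunctor (DerivedCategory (ModuleCat.{0} Λ)) k).map_surjective (f ≫ e.hom)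
  rw [hX.hom_neg_shift_vanish i j (l - k) (by lia) g, Functor.map_zero] at hg
  rw [← cancel_mono e.hom, ← hg, zero_comp]

lemma hom_shift_eq_zero_of_ne {i j : Fin r} (h : i ≠ j) {k : ℤ} (f : (X i)⟦k⟧ ⟶ (X j)⟦k⟧) :
    f = 0 := by
  obtain ⟨g, rfl⟩ := (shiftFunctor (DerivedCategory (ModuleCat.{0} Λ)) k).map_surjective f
  rw [hX.hom_ne_vanish i j h g, Functor.map_zero]

lemma id_ne_zero (i : Fin r) : 𝟙 (X i) ≠ 0 := by
  intro h0
  have : Subsingleton (X i ⟶ X i) := ⟨fun a b => by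
    rw [← Category.comp_id a, ← Category.comp_id b, h0, comp_zero, comp_zero]⟩
  have h1 := hX.end_dim i
  rw [Module.finrank_zero_of_subsingleton] at h1
  exact zero_ne_one h1

lemma exists_smul_id_eq (i : Fin r) (k : ℤ) (f : (X i)⟦k⟧ ⟶ (X i)⟦k⟧) :
    ∃ c : K, f = c • 𝟙 _ := by
  have := shiftFunctor_linear (Λ := Λ) K k
  obtain ⟨g, rfl⟩ := (shiftFunctor (DerivedCategory (ModuleCat.{0} Λ)) k).map_surjective f
  obtain ⟨c, hc⟩ := (finrank_eq_one_iff_of_nonzero' (𝟙 (X i)) (hX.id_ne_zero i)).1 (hX.end_dim i) g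
  exact ⟨c, by rw [← hc, Functor.map_smul, CategoryTheory.Functor.map_id]⟩

lemma exists_isGE : ∃ a : ℤ, ∀ i, (X i).IsGE a := by
  choose a b ha hb using fun i => (hX.mem_Db i).exists_isGE_isLE
  obtain ⟨c, hc⟩ := (Set.finite_range a).bddBelow
  exact ⟨c, fun i => isGE_mono _ _ _ (hc ⟨i, rfl⟩) (ha i)⟩

lemma factorsFinitely_shift {ι : Type*} {Y : ι → DerivedCategory (ModuleCat.{0} Λ)}
    {Z : DerivedCategory (ModuleCat.{0} Λ)} {inc : ∀ p, Y p ⟶ Z}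
    (hc : IsColimit (Cofan.mk Z inc)) {a : ℤ} (hZ : Z.IsGE a) (j : Fin r) (k : ℤ) :
    FactorsFinitely hc ((X j)⟦k⟧) := by
  have : IsNoetherianRing Λ := isNoetherian_of_tower K inferInstance
  obtain ⟨-, b, -, hb⟩ := (hX.mem_Db j).exists_isGE_isLE
  exact factorsFinitely_of_isGE hc a hZ (b - k - a + 1).toNat (b - k) (by lia) _
    (isLE_shift _ b k (b - k) (by lia) hb) ((hX.mem_Db j).hasFiniteHomology.shift k)

end IsSimpleMindedCollection

end Rickard

section Shift

variable {D : Type u} [Category.{v} D] [Preadditive D] [HasZeroObject D] [HasShift D ℤ]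
  [∀ n : ℤ, (shiftFunctor D n).Additive] [Pretriangulated D]

/-- If no nonzero morphism `W⟦k - 1⟧ ⟶ A` is killed by the first morphism of a distinguished
triangle with third morphism `B ⟶ A⟦1⟧`, then every morphism `W⟦k⟧ ⟶ B` lifts to the middle. -/
lemma exists_lift_mor₂_of_shift (T : Triangle D) (hT : T ∈ distTriang D) (W : D) (k : ℤ)
    (h : ∀ u : W⟦k - 1⟧ ⟶ T.obj₁, u ≫ T.mor₁ = 0 → u = 0) (f : W⟦k⟧ ⟶ T.obj₃) :
    ∃ g : W⟦k⟧ ⟶ T.obj₂, f = g ≫ T.mor₂ := by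
  apply Triangle.coyoneda_exact₃ T hT
  let e := (shiftFunctorAdd' D (k - 1) 1 k (by lia)).app W
  obtain ⟨u, hu⟩ := (shiftFunctor D (1 : ℤ)).map_surjective (e.inv ≫ f ≫ T.mor₃)
  have hu0 : u = 0 := h u <| (shiftFunctor D (1 : ℤ)).map_injective <| by
    rw [Functor.map_comp, hu, Category.assoc, Category.assoc, comp_distTriang_mor_zero₃₁ T hT,
      comp_zero, comp_zero, Functor.map_zero]
  rw [← cancel_epi e.inv, comp_zero, ← hu, hu0, Functor.map_zero]

end Shift

section Rickard

variable {K : Type} [Field K] [IsAlgClosed K]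
  {Λ : Type} [Ring Λ] [Algebra K Λ] [FiniteDimensional K Λ]
  [HasDerivedCategory.{w} (ModuleCat.{0} Λ)]
  [CategoryTheory.Linear K (DerivedCategory (ModuleCat.{0} Λ))]
  [(DerivedCategory.Qh (C := ModuleCat.{0} Λ)).Linear K]
  {r : ℕ} {X : Fin r → DerivedCategory (ModuleCat.{0} Λ)}
  (hX : IsSimpleMindedCollection K Λ r X) (R : RickardData K r X)

namespace RickardData

lemma isGE_Z {a : ℤ} (ha : ∀ i, (X i).IsGE a) (i : Fin r) (n : ℕ) : (R.Z i n).IsGE (a + 1) := by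
  refine isGE_of_isColimit (R.isColimitZ i n).some (a + 1) ?_
  rintro ⟨j, m, f, hm, hf⟩
  exact isGE_mono _ (a - m) _ (by lia) (isGE_shift _ a m (a - m) (by lia) (ha j))

lemma isGE_Xs {a : ℤ} (ha : ∀ i, (X i).IsGE a) (i : Fin r) (n : ℕ) : (R.Xs i n).IsGE a := by
  induction n with
  | zero =>
    rw [R.Xs_zero]
    exact ha i
  | succ n ih => exact isGE_cone _ (R.dist i n) a (R.isGE_Z ha i n) ih

lemma isGE_CP {a : ℤ} (ha : ∀ i, (X i).IsGE a) (i : Fin r) : (R.CP i).IsGE a :=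
  isGE_of_isColimit (R.isColimitCP i).some a fun n => R.isGE_Xs ha i n

include hX

lemma factorsFinitely_Z (i j : Fin r) (n : ℕ) (k : ℤ) :
    FactorsFinitely (R.isColimitZ i n).some ((X j)⟦k⟧) := by
  obtain ⟨a, ha⟩ := hX.exists_isGE
  exact hX.factorsFinitely_shift _ (R.isGE_Z ha i n) j k

lemma factorsFinitely_CP (i j : Fin r) (k : ℤ) :
    FactorsFinitely (R.isColimitCP i).some ((X j)⟦k⟧) := by
  obtain ⟨a, ha⟩ := hX.exists_isGE
  exact hX.factorsFinitely_shift _ (R.isGE_CP ha i) j k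

lemma hom_Z_eq_zero (i j : Fin r) (n : ℕ) {k : ℤ} (hk : 0 ≤ k) (f : (X j)⟦k⟧ ⟶ R.Z i n) :
    f = 0 := by
  obtain ⟨s, hs⟩ := (R.factorsFinitely_Z hX i j n k).eq_sum _ f
  rw [hs]
  refine Finset.sum_eq_zero fun p _ => ?_
  have h : f ≫ cofanProj (R.isColimitZ i n).some p = 0 :=
    hX.hom_shift_eq_zero_of_lt j p.1 (by have := p.2.2.2.1; lia) _
  rw [h, zero_comp]

lemma hom_Z_eq_zero_of_comp_α (i j : Fin r) (n : ℕ) (f : (X j)⟦(-1 : ℤ)⟧ ⟶ R.Z i n)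
    (hf : f ≫ R.α i n = 0) : f = 0 := by
  obtain ⟨s, hs⟩ := (R.factorsFinitely_Z hX i j n (-1)).eq_sum _ f
  let ν : R.B j (-1) i n → Σ (j : Fin r) (m : ℤ),
      {f : (X j)⟦m⟧ ⟶ R.Xs i n // m < 0 ∧ f ∈ R.B j m i n} :=
    fun q => ⟨j, -1, q.1, by lia, q.2⟩
  have hν : Function.Injective ν := by
    intro q q' h
    simpa [ν, Subtype.ext_iff] using h
  have hzero : ∀ p, p ∉ Set.range ν → f ≫ cofanProj (R.isColimitZ i n).some p = 0 := by
    rintro ⟨l, m, g, hm, hg⟩ hp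
    rcases eq_or_ne m (-1) with rfl | hm'
    · rcases eq_or_ne j l with rfl | hl
      · exact absurd ⟨⟨g, hg⟩, rfl⟩ hp
      · exact hX.hom_shift_eq_zero_of_ne hl _
    · exact hX.hom_shift_eq_zero_of_lt j l (by lia) _
  choose c hc using fun q : R.B j (-1) i n =>
    hX.exists_smul_id_eq j (-1) (f ≫ cofanProj (R.isColimitZ i n).some (ν q))
  have hsum : ∑ q ∈ s.preimage ν hν.injOn, c q • (q : (X j)⟦(-1 : ℤ)⟧ ⟶ R.Xs i n) = 0 := by
    rw [← hf]
    conv_rhs => rw [hs, Preadditive.sum_comp]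
    rw [← Finset.sum_preimage ν s hν.injOn]
    · refine Finset.sum_congr rfl fun q _ => ?_
      rw [Category.assoc, R.inc_α, hc q, Linear.smul_comp, Category.id_comp]
    · intro p _ hp
      rw [hzero p hp, zero_comp, zero_comp]
  have hcz := linearIndependent_iff'.1 (R.B_indep j (-1) i n (by lia)) _ c hsum
  rw [hs]
  refine Finset.sum_eq_zero fun p hp => ?_
  by_cases h : p ∈ Set.range ν
  · obtain ⟨q, rfl⟩ := h
    rw [hc q, hcz q (Finset.mem_preimage.2 hp), zero_smul, zero_comp]
  · rw [hzero p h, zero_comp]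

lemma exists_eq_comp_β (i j : Fin r) (n : ℕ) {k : ℤ} (hk : 0 ≤ k)
    (f : (X j)⟦k⟧ ⟶ R.Xs i (n + 1)) : ∃ g : (X j)⟦k⟧ ⟶ R.Xs i n, f = g ≫ R.β i n := by
  refine exists_lift_mor₂_of_shift _ (R.dist i n) (X j) k (fun u hu => ?_) f
  rcases eq_or_lt_of_le hk with rfl | hk
  · exact R.hom_Z_eq_zero_of_comp_α hX i j n u hu
  · exact R.hom_Z_eq_zero hX i j n (by lia) u

lemma eq_zero_of_comp_β (i j : Fin r) (n : ℕ) {k : ℤ} (hk : 0 ≤ k)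
    (f : (X j)⟦k⟧ ⟶ R.Xs i n) (hf : f ≫ R.β i n = 0) : f = 0 := by
  obtain ⟨g, hg⟩ : ∃ g : (X j)⟦k⟧ ⟶ R.Z i n, f = g ≫ R.α i n :=
    Triangle.coyoneda_exact₂ _ (R.dist i n) f hf
  rw [hg, R.hom_Z_eq_zero hX i j n hk g, zero_comp]

omit hX in
lemma comp_β_eq_zero (i j : Fin r) (n : ℕ) {k : ℤ} (hk : k < 0)
    (f : (X j)⟦k⟧ ⟶ R.Xs i n) : f ≫ R.β i n = 0 := by
  have h : Submodule.span K (R.B j k i n) ≤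
      LinearMap.ker (Linear.rightComp K ((X j)⟦k⟧) (R.β i n)) := by
    rw [Submodule.span_le]
    intro g hg
    have hα : R.inc i n ⟨j, k, g, hk, hg⟩ ≫ R.α i n = g := R.inc_α i n ⟨j, k, g, hk, hg⟩
    have hβ : R.α i n ≫ R.β i n = 0 := comp_distTriang_mor_zero₁₂ _ (R.dist i n)
    change g ≫ R.β i n = 0
    rw [← hα, Category.assoc, hβ, comp_zero]
  rw [R.B_span j k i n hk] at h
  exact h (Submodule.mem_top (x := f))

lemma hom_Xs_eq_zero (i j : Fin r) (n : ℕ) {k : ℤ} (hk : 0 ≤ k) (h : i ≠ j ∨ 0 < k)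
    (f : (X j)⟦k⟧ ⟶ R.Xs i n) : f = 0 := by
  induction n with
  | zero =>
    have : ∀ Y, Y = X i → ∀ g : (X j)⟦k⟧ ⟶ Y, g = 0 := by
      rintro _ rfl g
      let e := (shiftFunctorZero (DerivedCategory (ModuleCat.{0} Λ)) ℤ).app (X i)
      rw [← cancel_mono e.inv, zero_comp]
      rcases eq_or_lt_of_le hk with rfl | hk
      · exact hX.hom_shift_eq_zero_of_ne (h.resolve_right (lt_irrefl _)).symm _
      · exact hX.hom_shift_eq_zero_of_lt j i hk _
    exact this _ (R.Xs_zero i) f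
  | succ n ih =>
    obtain ⟨g, rfl⟩ := R.exists_eq_comp_β hX i j n hk f
    rw [ih g, zero_comp]

omit hX in
/-- The canonical morphism `X_i ⟶ X_i⁽ⁿ⁾`. -/
def ofX (i : Fin r) : ∀ n : ℕ, (X i)⟦(0 : ℤ)⟧ ⟶ R.Xs i n
  | 0 => (shiftFunctorZero (DerivedCategory (ModuleCat.{0} Λ)) ℤ).hom.app (X i) ≫
      eqToHom (R.Xs_zero i).symm
  | n + 1 => ofX i n ≫ R.β i n

lemma ofX_ne_zero (i : Fin r) (n : ℕ) : R.ofX i n ≠ 0 := by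
  induction n with
  | zero =>
    intro h
    apply hX.id_ne_zero i
    rw [ofX, ← cancel_mono (eqToHom (R.Xs_zero i)), Category.assoc, eqToHom_trans, eqToHom_refl,
      Category.comp_id, zero_comp] at h
    rw [← cancel_epi ((shiftFunctorZero (DerivedCategory (ModuleCat.{0} Λ)) ℤ).hom.app (X i)), h]
    exact zero_comp.trans zero_comp.symm
  | succ n ih => exact fun h => ih (R.eq_zero_of_comp_β hX i i n le_rfl _ h)

lemma exists_eq_smul_ofX (i : Fin r) (n : ℕ) (f : (X i)⟦(0 : ℤ)⟧ ⟶ R.Xs i n) :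
    ∃ c : K, f = c • R.ofX i n := by
  induction n with
  | zero =>
    obtain ⟨c, hc⟩ := hX.exists_smul_id_eq i 0 (f ≫ eqToHom (R.Xs_zero i) ≫
      (shiftFunctorZero (DerivedCategory (ModuleCat.{0} Λ)) ℤ).inv.app (X i))
    refine ⟨c, ?_⟩
    rw [← cancel_mono (eqToHom (R.Xs_zero i) ≫
      (shiftFunctorZero (DerivedCategory (ModuleCat.{0} Λ)) ℤ).inv.app (X i)), hc, ofX,
      Linear.smul_comp]
    simp
  | succ n ih =>
    obtain ⟨g, rfl⟩ := R.exists_eq_comp_β hX i i n le_rfl f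
    obtain ⟨c, rfl⟩ := ih g
    exact ⟨c, by rw [ofX, Linear.smul_comp]⟩

omit hX in
lemma oneSubβ_proj_zero (i : Fin r) :
    R.oneSubβ i ≫ cofanProj (R.isColimitCP i).some 0 = cofanProj (R.isColimitCP i).some 0 := by
  refine cofan_hom_ext (R.isColimitCP i).some fun n => ?_
  rw [← Category.assoc, R.cinc_oneSubβ, Preadditive.sub_comp, Category.assoc,
    inc_cofanProj_ne _ (Nat.succ_ne_zero n), comp_zero, sub_zero]

omit hX in
lemma oneSubβ_proj_succ (i : Fin r) (n : ℕ) :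
    R.oneSubβ i ≫ cofanProj (R.isColimitCP i).some (n + 1) =
      cofanProj (R.isColimitCP i).some (n + 1) -
        cofanProj (R.isColimitCP i).some n ≫ R.β i n := by
  refine cofan_hom_ext (R.isColimitCP i).some fun m => ?_
  rw [← Category.assoc, R.cinc_oneSubβ, Preadditive.sub_comp, Category.assoc,
    Preadditive.comp_sub]
  congr 1
  rcases eq_or_ne m n with rfl | h
  · rw [inc_cofanProj_self, Category.comp_id, ← Category.assoc, inc_cofanProj_self,
      Category.id_comp]
  · rw [inc_cofanProj_ne _ (by lia), comp_zero, ← Category.assoc, inc_cofanProj_ne _ h, zero_comp]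

omit hX in
lemma cinc_toT (i : Fin r) (n : ℕ) :
    R.cinc i n ≫ R.toT i = R.β i n ≫ R.cinc i (n + 1) ≫ R.toT i := by
  have h : R.oneSubβ i ≫ R.toT i = 0 := comp_distTriang_mor_zero₁₂ _ (R.distT i)
  have h' := R.cinc i n ≫= h
  rw [← Category.assoc, R.cinc_oneSubβ, comp_zero, Preadditive.sub_comp, sub_eq_zero,
    Category.assoc] at h'
  exact h'

lemma hom_CP_eq_zero_of_comp_oneSubβ (i j : Fin r) (k : ℤ) (f : (X j)⟦k⟧ ⟶ R.CP i)
    (hf : f ≫ R.oneSubβ i = 0) : f = 0 := by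
  have hproj : ∀ n, f ≫ cofanProj (R.isColimitCP i).some n = 0 := by
    intro n
    induction n with
    | zero => rw [← R.oneSubβ_proj_zero, ← Category.assoc, hf, zero_comp]
    | succ n ih =>
      have h := f ≫= R.oneSubβ_proj_succ i n
      rw [← Category.assoc, hf, zero_comp, Preadditive.comp_sub, ← Category.assoc f _ (R.β i n),
        ih, zero_comp, sub_zero] at h
      exact h.symm
  obtain ⟨s, hs⟩ := (R.factorsFinitely_CP hX i j k).eq_sum _ f
  rw [hs]
  exact Finset.sum_eq_zero fun n _ => by rw [hproj, zero_comp]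

lemma exists_eq_sum_comp_toT (i j : Fin r) (k : ℤ) (f : (X j)⟦k⟧ ⟶ R.T i) :
    ∃ (s : Finset ℕ) (g : ∀ n, (X j)⟦k⟧ ⟶ R.Xs i n),
      f = ∑ n ∈ s, g n ≫ R.cinc i n ≫ R.toT i := by
  obtain ⟨v, rfl⟩ : ∃ v : (X j)⟦k⟧ ⟶ R.CP i, f = v ≫ R.toT i :=
    exists_lift_mor₂_of_shift _ (R.distT i) (X j) k
      (R.hom_CP_eq_zero_of_comp_oneSubβ hX i j (k - 1)) f
  obtain ⟨s, hs⟩ := (R.factorsFinitely_CP hX i j k).eq_sum _ v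
  refine ⟨s, fun n => v ≫ cofanProj (R.isColimitCP i).some n, ?_⟩
  conv_lhs => rw [hs]
  rw [Preadditive.sum_comp]
  exact Finset.sum_congr rfl fun n _ => Category.assoc _ _ _

lemma hom_T_eq_zero (i j : Fin r) {k : ℤ} (h : ¬ (i = j ∧ k = 0)) (f : (X j)⟦k⟧ ⟶ R.T i) :
    f = 0 := by
  obtain ⟨s, g, rfl⟩ := R.exists_eq_sum_comp_toT hX i j k f
  refine Finset.sum_eq_zero fun n _ => ?_
  rcases lt_or_ge k 0 with hk | hk
  · rw [R.cinc_toT, ← Category.assoc, R.comp_β_eq_zero i j n hk, zero_comp]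
  · rw [R.hom_Xs_eq_zero hX i j n hk ?_ (g n), zero_comp]
    by_contra! h'
    exact h ⟨h'.1, by lia⟩

omit hX in
lemma ofX_cinc_toT (i : Fin r) (n : ℕ) :
    R.ofX i n ≫ R.cinc i n ≫ R.toT i = R.ofX i 0 ≫ R.cinc i 0 ≫ R.toT i := by
  induction n with
  | zero => rfl
  | succ n ih => rw [← ih, R.cinc_toT i n, ofX, Category.assoc]

lemma ofX_cinc_toT_ne_zero (i : Fin r) : R.ofX i 0 ≫ R.cinc i 0 ≫ R.toT i ≠ 0 := by
  intro h
  rw [← Category.assoc] at h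
  obtain ⟨g, hg⟩ : ∃ g : (X i)⟦(0 : ℤ)⟧ ⟶ R.CP i, R.ofX i 0 ≫ R.cinc i 0 = g ≫ R.oneSubβ i :=
    Triangle.coyoneda_exact₂ _ (R.distT i) (R.ofX i 0 ≫ R.cinc i 0) h
  have hproj : ∀ n, g ≫ cofanProj (R.isColimitCP i).some n = R.ofX i n := by
    intro n
    induction n with
    | zero =>
      rw [← R.oneSubβ_proj_zero, ← Category.assoc, ← hg, Category.assoc, inc_cofanProj_self,
        Category.comp_id]
    | succ n ih =>
      have h := g ≫= R.oneSubβ_proj_succ i n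
      rw [← Category.assoc, ← hg, Category.assoc, inc_cofanProj_ne _ (Nat.succ_ne_zero n).symm,
        comp_zero, Preadditive.comp_sub, ← Category.assoc g _ (R.β i n), ih] at h
      exact sub_eq_zero.1 h.symm
  obtain ⟨s, hs⟩ := R.factorsFinitely_CP hX i i 0 g
  obtain ⟨n, hn⟩ := Infinite.exists_notMem_finset s
  apply R.ofX_ne_zero hX i n
  rw [← hproj, ← hs, Category.assoc, cofanTrunc, Preadditive.sum_comp, Finset.sum_eq_zero,
    comp_zero]
  intro m hm
  rw [Category.assoc, inc_cofanProj_ne _ (by rintro rfl; exact hn hm), comp_zero]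

lemma exists_eq_smul_hom_T (i : Fin r) (f : (X i)⟦(0 : ℤ)⟧ ⟶ R.T i) :
    ∃ c : K, f = c • (R.ofX i 0 ≫ R.cinc i 0 ≫ R.toT i) := by
  obtain ⟨s, g, rfl⟩ := R.exists_eq_sum_comp_toT hX i i 0 f
  choose c hc using fun n => R.exists_eq_smul_ofX hX i n (g n)
  refine ⟨∑ n ∈ s, c n, ?_⟩
  rw [Finset.sum_smul]
  refine Finset.sum_congr rfl fun n _ => ?_
  rw [hc n, Linear.smul_comp, R.ofX_cinc_toT]

end RickardData

end Rickard

end RickardKoenigYang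

namespace RickardKoenigYang

/-- **Lemma 5.4 of Rickard's construction** (Lemma `L:T` a)).
For `1 ≤ i, j ≤ r` and `m ∈ ℤ`, the space `Hom(X_j, Σ^m T_i)` is one-dimensional
over `K` if `i = j` and `m = 0`, and vanishes otherwise. -/
theorem hom_simpleMinded_to_shift_rickardT
    (K : Type) [Field K] [IsAlgClosed K]
    (Λ : Type) [Ring Λ] [Algebra K Λ] [FiniteDimensional K Λ]
    (hbasic : IsBasicAlgebra K Λ)
    [HasDerivedCategory (ModuleCat.{0} Λ)]
    [CategoryTheory.Linear K (DerivedCategory (ModuleCat.{0} Λ))]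
    [(DerivedCategory.Qh (C := ModuleCat.{0} Λ)).Linear K]
    (r : ℕ) (hr : IsCompleteFamilyOfSimples Λ r)
    (X : Fin r → DerivedCategory (ModuleCat.{0} Λ))
    (hX : IsSimpleMindedCollection K Λ r X)
    (R : RickardData K r X) :
    ∀ (i j : Fin r) (m : ℤ),
      (i = j ∧ m = 0 → Module.finrank K (X j ⟶ (R.T i)⟦m⟧) = 1) ∧
      (¬ (i = j ∧ m = 0) → ∀ f : X j ⟶ (R.T i)⟦m⟧, f = 0) := by
  intro i j m
  constructor
  · rintro ⟨rfl, rfl⟩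
    let e := (shiftFunctorZero (DerivedCategory (ModuleCat.{0} Λ)) ℤ).app (X i)
    let e' := (shiftFunctorZero (DerivedCategory (ModuleCat.{0} Λ)) ℤ).app (R.T i)
    refine finrank_eq_one (e.inv ≫ (R.ofX i 0 ≫ R.cinc i 0 ≫ R.toT i) ≫ e'.inv) ?_ ?_
    · intro h
      apply R.ofX_cinc_toT_ne_zero hX i
      rw [← cancel_mono e'.inv, ← cancel_epi e.inv, h, zero_comp, comp_zero]
    · intro f
      obtain ⟨c, hc⟩ := R.exists_eq_smul_hom_T hX i (e.hom ≫ f ≫ e'.hom)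
      refine ⟨c, ?_⟩
      rw [← Linear.comp_smul, ← Linear.smul_comp, ← hc]
      simp
  · intro h f
    let e := (shiftFunctorCompIsoId (DerivedCategory (ModuleCat.{0} Λ)) m (-m) (by lia)).app (R.T i)
    apply (shiftFunctor (DerivedCategory (ModuleCat.{0} Λ)) (-m)).map_injective
    rw [← cancel_mono e.hom, Functor.map_zero, zero_comp]
    exact R.hom_T_eq_zero hX i j (by rintro ⟨h1, h2⟩; exact h ⟨h1, by lia⟩) _

end RickardKoenigYang
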